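/- Let K be a field, let n ≥ 2 and 2 ≤ m ≤ n, and let J be the ideal of R = MvPolynomial (Fin n) K generated by the m monomials ∏_{j<m, j≠i} X_j (for i < m). Then the Krull dimension of the quotient ring R ⧸ J equals n − 2, i.e. ringKrullDim (R ⧸ J) = n − 2. -/

import Mathlib

open MvPolynomial

/-- The Krull dimension of `R ⧸ I` is bounded by any common bound for the Krull dimensions of the
quotients of `R` by the primes containing `I`. -/
theorem ringKrullDim_quotient_le_of_forall_isPrime {R : Type*} [CommRing R] {I : Ideal R}
    {d : WithBot ℕ∞} (h : ∀ p : Ideal R, p.IsPrime → I ≤ p → ringKrullDim (R ⧸ p) ≤ d) :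
    ringKrullDim (R ⧸ I) ≤ d := by
  rw [ringKrullDim_quotient]
  refine iSup_le fun l => ?_
  refine le_trans ?_ (h l.head.1.asIdeal l.head.1.isPrime l.head.2)
  rw [ringKrullDim_quotient]
  let l' : LTSeries (PrimeSpectrum.zeroLocus (R := R) l.head.1.asIdeal) :=
    { length := l.length
      toFun := fun k => ⟨(l k).1, l.head_le k⟩
      step := l.step }
  exact Order.LTSeries.length_le_krullDim l'

theorem MvPolynomial.killCompl_X_apply {σ τ R : Type*} [CommSemiring R] {f : σ → τ}
    (hf : Function.Injective f) (i : σ) : killCompl (R := R) hf (X (f i)) = X i := by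
  rw [← rename_X, killCompl_rename_app]

theorem MvPolynomial.killCompl_X_of_notMem_range {σ τ R : Type*} [CommSemiring R] {f : σ → τ}
    (hf : Function.Injective f) {i : τ} (hi : i ∉ Set.range f) :
    killCompl (R := R) hf (X i) = 0 := by
  rw [killCompl, aeval_X, dif_neg hi]

section CoordinateSubspace

variable {σ K : Type*} [Finite σ] [Field K]

theorem MvPolynomial.ringKrullDim_eq_natCard_of_field :
    ringKrullDim (MvPolynomial σ K) = (Nat.card σ : ℕ) := by
  rw [MvPolynomial.ringKrullDim_of_isNoetherianRing, ringKrullDim_eq_zero_of_field, zero_add]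

theorem MvPolynomial.ringKrullDim_quotient_le_natCard {s : Set σ} {I : Ideal (MvPolynomial σ K)}
    (hI : ∀ i ∉ s, X i ∈ I) : ringKrullDim (MvPolynomial σ K ⧸ I) ≤ (Nat.card s : ℕ) := by
  let g : MvPolynomial s K →ₐ[K] MvPolynomial σ K ⧸ I :=
    (Ideal.Quotient.mkₐ K I).comp (rename Subtype.val)
  have hg : g.comp (killCompl Subtype.val_injective) = Ideal.Quotient.mkₐ K I := by
    ext i
    by_cases hi : i ∈ s
    · have := killCompl_X_apply (R := K) (Subtype.val_injective (p := (· ∈ s))) ⟨i, hi⟩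
      simp_all [g]
    · have hi' : Ideal.Quotient.mk I (X i) = 0 := Ideal.Quotient.eq_zero_iff_mem.2 (hI i hi)
      have := killCompl_X_of_notMem_range (R := K) (i := i)
        (Subtype.val_injective (p := (· ∈ s))) (by simpa using hi)
      simp_all
  rw [← ringKrullDim_eq_natCard_of_field (K := K)]
  refine ringKrullDim_le_of_surjective g.toRingHom fun y => ?_
  obtain ⟨q, rfl⟩ := Ideal.Quotient.mkₐ_surjective K I y
  exact ⟨killCompl Subtype.val_injective q, DFunLike.congr_fun hg q⟩

theorem MvPolynomial.natCard_le_ringKrullDim_quotient {s : Set σ} {I : Ideal (MvPolynomial σ K)}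
    (hI : I ≤ Ideal.span (X '' sᶜ)) :
    (Nat.card s : ℕ) ≤ ringKrullDim (MvPolynomial σ K ⧸ I) := by
  let g : MvPolynomial σ K →ₐ[K] MvPolynomial s K := killCompl Subtype.val_injective
  have hg : I ≤ RingHom.ker g := by
    refine hI.trans (Ideal.span_le.2 ?_)
    rintro _ ⟨i, hi, rfl⟩
    exact killCompl_X_of_notMem_range _ (by simpa using hi)
  rw [← ringKrullDim_eq_natCard_of_field (K := K)]
  refine ringKrullDim_le_of_surjective (Ideal.Quotient.lift I g.toRingHom hg)
    (Ideal.Quotient.lift_surjective_of_surjective _ _ fun q => ?_)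
  exact ⟨rename Subtype.val q, killCompl_rename_app _ q⟩

end CoordinateSubspace

theorem Nat.card_compl_pair {σ : Type*} [Finite σ] {i j : σ} (hij : i ≠ j) :
    Nat.card (({i, j} : Set σ)ᶜ : Set σ) = Nat.card σ - 2 := by
  rw [Nat.card_coe_set_eq, Set.ncard_compl, Set.ncard_pair hij]

/-- In `R = MvPolynomial (Fin n) K`, the quotient of `R` by the ideal generated by the `m`
monomials `∏_{j < m, j ≠ i} X j` (for `i < m`) — the Jacobian ideal of the normal crossing
polynomial `X 0 * ⋯ * X (m-1)` — has Krull dimension `n - 2`. -/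
theorem ringKrullDim_quotient_jacobian_of_normal_crossing
    (K : Type*) [Field K] (n m : ℕ) (hn : 2 ≤ n) (hm2 : 2 ≤ m) (hmn : m ≤ n)
    (J : Ideal (MvPolynomial (Fin n) K))
    (hJ : J = Ideal.span { q : MvPolynomial (Fin n) K | ∃ i : Fin n, (i : ℕ) < m ∧
        q = ∏ j ∈ Finset.univ.filter (fun j : Fin n => (j : ℕ) < m ∧ j ≠ i), X j }) :
    ringKrullDim (MvPolynomial (Fin n) K ⧸ J) = (n - 2 : ℕ) := by
  subst hJ
  let a : Fin n := ⟨0, by omega⟩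
  let b : Fin n := ⟨1, by omega⟩
  have hab : a ≠ b := by simp [a, b]
  apply le_antisymm
  · refine ringKrullDim_quotient_le_of_forall_isPrime fun p hp hJp => ?_
    have exists_X_mem (i : Fin n) (hi : (i : ℕ) < m) :
        ∃ j : Fin n, (j : ℕ) < m ∧ j ≠ i ∧ X j ∈ p := by
      obtain ⟨j, hj, hjp⟩ := hp.prod_mem_iff.1 (hJp (Ideal.subset_span ⟨i, hi, rfl⟩))
      obtain ⟨hjm, hji⟩ := (Finset.mem_filter.1 hj).2
      exact ⟨j, hjm, hji, hjp⟩
    obtain ⟨i, him, -, hi⟩ := exists_X_mem a (by simp only [a]; omega)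
    obtain ⟨j, -, hji, hj⟩ := exists_X_mem i him
    have h := ringKrullDim_quotient_le_natCard (s := {j, i}ᶜ) (I := p) (by
      intro k hk
      obtain rfl | rfl := not_not.1 hk <;> assumption)
    rwa [Nat.card_compl_pair hji, Nat.card_fin] at h
  · have h := natCard_le_ringKrullDim_quotient (K := K) (s := {a, b}ᶜ) (I := Ideal.span
      { q : MvPolynomial (Fin n) K | ∃ i : Fin n, (i : ℕ) < m ∧
        q = ∏ j ∈ Finset.univ.filter (fun j : Fin n => (j : ℕ) < m ∧ j ≠ i), X j }) (by
      rw [compl_compl]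
      refine Ideal.span_le.2 ?_
      rintro _ ⟨i, -, rfl⟩
      obtain ⟨c, hc, hcm, hci⟩ : ∃ c ∈ ({a, b} : Set (Fin n)), (c : ℕ) < m ∧ c ≠ i := by
        by_cases hi : a = i
        · exact ⟨b, by simp, by simp only [b]; omega, fun h => hab (hi.trans h.symm)⟩
        · exact ⟨a, by simp, by simp only [a]; omega, hi⟩
      exact Ideal.mem_of_dvd _ (Finset.dvd_prod_of_mem X (by simp [hcm, hci]))
        (Ideal.subset_span ⟨c, hc, rfl⟩))
    rwa [Nat.card_compl_pair hab, Nat.card_fin] at h
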